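/- Let m ≥ 2 and ℓ ≥ 1 be integers and let p ∈ [0,1] satisfy p^ℓ = 1/m^{100}. Fix a simple graph G whose edge set E has exactly m edges and which contains no cycle of length ≤ ℓ. Form m^{200} mutually independent random subsets B_1, …, B_{m^{200}} of E, each obtained by keeping every edge independently with probability p. Then with probability at least 1 − (2m)^4 · 2^{−m^{98}}, for every cycle C of G of length in (ℓ, 1.01·ℓ] there exists an index i ∈ [m^{200}] such that C is the unique cycle of G all of whose edges lie in B_i. -/

import Mathlib

/-- A finset of edges `C` is (the edge set of) a cycle of the simple graph `G`. -/
def IsCycleSet {V : Type*} [DecidableEq V] (G : SimpleGraph V) (C : Finset (Sym2 V)) : Prop :=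
  ∃ (u : V) (w : G.Walk u u), w.IsCycle ∧ C = w.edges.toFinset

/-- The probability of an event `A` for `N` mutually independent random subsets of the finite
set `E`, each obtained by keeping every element independently with probability `p`. -/
noncomputable def bernoulliTupleProb {α : Type*} [DecidableEq α] (E : Finset α) (p : ℝ)
    (N : ℕ) (A : Set (Fin N → Finset α)) : ℝ :=
  ∑ f ∈ Fintype.piFinset (fun _ : Fin N => E.powerset),
    Set.indicator A
      (fun f => ∏ i : Fin N, p ^ (f i).card * (1 - p) ^ (E.card - (f i).card)) f

open SimpleGraph in
theorem exists_cycle_edges_subset_of_even {V : Type*} [Fintype V] [DecidableEq V]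
    (G : SimpleGraph V) (D : Finset (Sym2 V)) (hDG : ∀ e ∈ D, e ∈ G.edgeSet) (hD : D.Nonempty)
    (heven : ∀ x, Even (D.filter (x ∈ ·)).card) :
    ∃ C, IsCycleSet G C ∧ C ⊆ D := by
  classical
  set H : SimpleGraph V := fromEdgeSet (D : Set (Sym2 V)) with hH
  have hHe : ∀ e, e ∈ H.edgeSet ↔ e ∈ D := by
    intro e
    rw [hH, edgeSet_fromEdgeSet]
    refine ⟨fun h => h.1, fun h => ⟨h, G.not_isDiag_of_mem_edgeSet (hDG e h)⟩⟩
  have hHdeg : ∀ x, Even (H.degree x) := by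
    intro x
    rw [← card_incidenceFinset_eq_degree, incidenceFinset_eq_filter]
    convert! heven x using 3
    ext e
    rw [mem_edgeFinset, hHe]
  by_cases hac : H.IsAcyclic
  · exfalso
    obtain ⟨e, he⟩ := hD
    induction e with | _ a b
    have hab : H.Adj a b := (hHe _).2 he
    set c := H.connectedComponentMk a with hc
    have ha : a ∈ c.supp := rfl
    have hb : b ∈ c.supp := ConnectedComponent.sound hab.symm.reachable
    have : Nontrivial c.supp := ⟨⟨a, ha⟩, ⟨b, hb⟩, fun h => hab.ne (congrArg Subtype.val h)⟩
    obtain ⟨v, hv⟩ := (hac.isTree_connectedComponent c).exists_vert_degree_one_of_nontrivial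
    have hd : c.toSimpleGraph.degree v = H.degree v := by
      have := degree_induce_of_neighborSet_subset (G := H) (s := c.supp) (v := v) (by
        intro w hw
        exact (ConnectedComponent.sound (Adj.reachable hw).symm).trans v.2)
      rw [← this]
      unfold ConnectedComponent.toSimpleGraph
      congr!
    have := hHdeg v
    rw [← hd, hv] at this
    exact absurd this (by decide)
  · simp only [IsAcyclic, not_forall, not_not] at hac
    obtain ⟨u, w, hw⟩ := hac
    have hwD : ∀ e ∈ w.edges, e ∈ D := fun e he => (hHe e).1 (w.edges_subset_edgeSet he)
    refine ⟨w.edges.toFinset, ⟨u, w.transfer G fun e he => hDG e (hwD e he), hw.transfer _, ?_⟩, ?_⟩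
    · simp
    · intro e he
      exact hwD e (by simpa using he)

theorem IsCycleSet.even_card_filter_mem {V : Type*} [DecidableEq V] {G : SimpleGraph V}
    {C : Finset (Sym2 V)} (hC : IsCycleSet G C) (x : V) : Even (C.filter (x ∈ ·)).card := by
  obtain ⟨u, w, hw, rfl⟩ := hC
  have h := (hw.isTrail.even_countP_edges_iff x).2 fun h => absurd rfl h
  have hn := hw.isTrail.edges_nodup
  rw [List.countP_eq_length_filter, ← List.toFinset_card_of_nodup (hn.filter _),
    List.toFinset_filter] at h
  simpa using h

theorem IsCycleSet.mem_edgeSet {V : Type*} [DecidableEq V] {G : SimpleGraph V}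
    {C : Finset (Sym2 V)} (hC : IsCycleSet G C) {e : Sym2 V} (he : e ∈ C) : e ∈ G.edgeSet := by
  obtain ⟨u, w, hw, rfl⟩ := hC
  exact w.edges_subset_edgeSet (by simpa using he)

theorem IsCycleSet.lt_card_sdiff_add_card_sdiff {V : Type*} [Fintype V] [DecidableEq V]
    {G : SimpleGraph V} {ℓ : ℕ} (hgirth : ∀ C : Finset (Sym2 V), IsCycleSet G C → ℓ < C.card)
    {C C' : Finset (Sym2 V)} (hC : IsCycleSet G C) (hC' : IsCycleSet G C') (hne : C' ≠ C) :
    ℓ < (C \ C').card + (C' \ C).card := by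
  have hdisj : Disjoint (C \ C') (C' \ C) := disjoint_sdiff_sdiff
  rw [← Finset.card_union_of_disjoint hdisj]
  obtain ⟨Z, hZ, hsub⟩ := exists_cycle_edges_subset_of_even G ((C \ C') ∪ (C' \ C))
    (fun e he => by
      rcases Finset.mem_union.1 he with h | h
      · exact hC.mem_edgeSet (Finset.mem_sdiff.1 h).1
      · exact hC'.mem_edgeSet (Finset.mem_sdiff.1 h).1)
    (by
      by_contra h
      rw [Finset.not_nonempty_iff_eq_empty, Finset.union_eq_empty, Finset.sdiff_eq_empty_iff_subset,
        Finset.sdiff_eq_empty_iff_subset] at h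
      exact hne (h.2.antisymm h.1))
    (fun x => by
      have h1 := hC.even_card_filter_mem x
      have h2 := hC'.even_card_filter_mem x
      rw [Finset.filter_union, Finset.card_union_of_disjoint
        (Finset.disjoint_filter_filter hdisj)]
      have e1 := Finset.card_sdiff_add_card_inter (C.filter (x ∈ ·)) (C'.filter (x ∈ ·))
      have e2 := Finset.card_sdiff_add_card_inter (C'.filter (x ∈ ·)) (C.filter (x ∈ ·))
      rw [Finset.inter_comm] at e2
      have f1 : (C \ C').filter (x ∈ ·) = C.filter (x ∈ ·) \ C'.filter (x ∈ ·) := by grind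
      have f2 : (C' \ C).filter (x ∈ ·) = C'.filter (x ∈ ·) \ C.filter (x ∈ ·) := by grind
      rw [f1, f2]
      grind)
  exact (hgirth Z hZ).trans_le (Finset.card_le_card hsub)

open SimpleGraph in
theorem path_eq_of_length_add_length_lt {V : Type*} {G : SimpleGraph V} {g : ℕ}
    (hgirth : ∀ (u : V) (w : G.Walk u u), w.IsCycle → g < w.length) {u v : V}
    {p q : G.Walk u v} (hp : p.IsPath) (hq : q.IsPath) (hpq : p.length + q.length ≤ g) : p = q := by
  classical
  set H : SimpleGraph V := fromEdgeSet {e | e ∈ p.edges ++ q.edges} with hH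
  have hHe : ∀ e, e ∈ H.edgeSet ↔ e ∈ p.edges ++ q.edges := by
    intro e
    rw [hH, edgeSet_fromEdgeSet]
    refine ⟨fun h => h.1, fun h => ⟨h, ?_⟩⟩
    rcases List.mem_append.1 h with h | h
    · exact G.not_isDiag_of_mem_edgeSet (p.edges_subset_edgeSet h)
    · exact G.not_isDiag_of_mem_edgeSet (q.edges_subset_edgeSet h)
  have hac : H.IsAcyclic := by
    intro a c hc
    have hcs : ∀ e ∈ c.edges, e ∈ p.edges ++ q.edges :=
      fun e he => (hHe e).1 (c.edges_subset_edgeSet he)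
    have h1 := hgirth a (c.transfer G fun e he => by
      rcases List.mem_append.1 (hcs e he) with h | h
      · exact p.edges_subset_edgeSet h
      · exact q.edges_subset_edgeSet h) (hc.transfer _)
    have h2 := (hc.isTrail.edges_nodup.subperm hcs).length_le
    simp only [Walk.length_transfer, List.length_append, Walk.length_edges] at h1 h2
    omega
  have hpH : ∀ e ∈ p.edges, e ∈ H.edgeSet := fun e he => (hHe e).2 (List.mem_append_left _ he)
  have hqH : ∀ e ∈ q.edges, e ∈ H.edgeSet := fun e he => (hHe e).2 (List.mem_append_right _ he)
  have h := (hac.subsingleton_path u v).elim ⟨p.transfer H hpH, hp.transfer hpH⟩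
    ⟨q.transfer H hqH, hq.transfer hqH⟩
  have h' := congrArg Walk.support (congrArg Subtype.val h)
  simp only [Walk.support_transfer] at h'
  exact Walk.ext_support h'

open SimpleGraph in
theorem edges_eq_of_getVert_eq {V : Type*} {G : SimpleGraph V} {s : ℕ} (hs : 0 < s)
    (hgirth : ∀ (u : V) (w : G.Walk u u), w.IsCycle → 2 * s < w.length) {u v : V}
    {c : G.Walk u u} {d : G.Walk v v} (hc : c.IsCycle) (hd : d.IsCycle) (j : ℕ)
    (hcj : c.length ≤ j * s) (hdj : d.length ≤ j * s)
    (h : ∀ k ≤ j, c.getVert (k * s) = d.getVert (k * s)) : c.edges = d.edges := by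
  have hpath : ∀ {u : V} {w : G.Walk u u}, w.IsCycle → ∀ k, ((w.drop (k * s)).take s).IsPath := by
    intro u w hw k
    rcases Nat.eq_zero_or_pos k with rfl | hk
    · have := hw.isPath_take (n := s) (by have := hgirth _ _ hw; omega)
      rw [Walk.isPath_def, Walk.support_take] at this ⊢
      simpa using this
    · exact (hw.isPath_drop (Nat.mul_pos hk hs)).take s
  have key : ∀ k ≤ j, c.edges.take (k * s) = d.edges.take (k * s) := by
    intro k
    induction k with
    | zero => simp
    | succ k ih =>
      intro hk
      have h0 := h k (by omega)
      have h1 := h (k + 1) hk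
      rw [Nat.succ_mul, List.take_add, List.take_add, ih (by omega), ← Walk.edges_drop,
        ← Walk.edges_drop, ← Walk.edges_take, ← Walk.edges_take]
      congr 1
      have hpc := hpath hc k
      have hpd := hpath hd k
      have h1' : (c.drop (k * s)).getVert s = (d.drop (k * s)).getVert s := by
        rw [Walk.drop_getVert, Walk.drop_getVert, ← Nat.succ_mul, h1]
      have := path_eq_of_length_add_length_lt hgirth hpc
        (q := ((d.drop (k * s)).take s).copy h0.symm h1'.symm) (by simpa using hpd) (by
          simp only [Walk.length_copy, Walk.take_length]; omega)
      rw [this, Walk.edges_copy, Walk.edges_take]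
  have := key j le_rfl
  rwa [List.take_of_length_le (by simpa using hcj), List.take_of_length_le (by simpa using hdj)]
    at this

open SimpleGraph in
theorem card_cycles_le {V : Type*} [Fintype V] [DecidableEq V] (G : SimpleGraph V)
    [DecidableRel G.Adj] {s : ℕ} (hs : 0 < s)
    (hgirth : ∀ (u : V) (w : G.Walk u u), w.IsCycle → 2 * s < w.length) (j : ℕ)
    (F : Finset (Finset (Sym2 V))) (hF : ∀ C ∈ F, IsCycleSet G C ∧ C.card ≤ j * s) :
    F.card ≤ (2 * G.edgeFinset.card) ^ j := by
  classical
  have hsupp : G.support.toFinset.card ≤ 2 * G.edgeFinset.card := by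
    rw [← sum_degrees_support_eq_twice_card_edges, Finset.card_eq_sum_ones]
    refine Finset.sum_le_sum fun v hv => ?_
    rw [Set.mem_toFinset] at hv
    by_contra h
    exact (degree_eq_zero_iff_notMem_support (G := G) (v := v)).1 (by omega) hv
  have hex : ∀ C : F, ∃ (u : V) (w : G.Walk u u), w.IsCycle ∧ C.1 = w.edges.toFinset :=
    fun C => (hF C.1 C.2).1
  choose u w hw hCw using hex
  have hlen : ∀ C : F, (w C).length ≤ j * s := by
    intro C
    have := (hF C.1 C.2).2
    rwa [hCw C, List.toFinset_card_of_nodup (hw C).isTrail.edges_nodup, Walk.length_edges] at this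
  let f : F → (Fin j → V) := fun C k => (w C).getVert (k * s)
  have hinj : Function.Injective f := by
    intro C D hCD
    have hk : ∀ k < j, (w C).getVert (k * s) = (w D).getVert (k * s) :=
      fun k hk => congrFun hCD ⟨k, hk⟩
    have hj : 0 < j := by
      by_contra h0
      obtain rfl : j = 0 := by omega
      have := hgirth _ _ (hw C)
      have := hlen C
      omega
    apply Subtype.ext
    rw [hCw C, hCw D]
    congr 1
    refine edges_eq_of_getVert_eq hs hgirth (hw C) (hw D) j (hlen C) (hlen D) fun k hkj => ?_
    rcases hkj.lt_or_eq with h | rfl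
    · exact hk k h
    · rw [Walk.getVert_of_length_le _ (hlen C), Walk.getVert_of_length_le _ (hlen D)]
      simpa using hk 0 hj
  have hmaps : ∀ C ∈ (Finset.univ : Finset F),
      f C ∈ Fintype.piFinset fun _ : Fin j => G.support.toFinset := by
    intro C _
    rw [Fintype.mem_piFinset]
    intro k
    rw [Set.mem_toFinset]
    exact mem_support_of_mem_walk_support (w C) (hw C).not_nil ((w C).getVert_mem_support _)
  have := Finset.card_le_card_of_injOn f hmaps hinj.injOn
  rw [Fintype.card_piFinset_const, Finset.card_univ, Fintype.card_coe] at this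
  exact this.trans (Nat.pow_le_pow_left hsupp j)

theorem sum_biUnion_le_of_nonneg {α ι : Type*} [DecidableEq α] {f : α → ℝ} (hf : ∀ a, 0 ≤ f a)
    (F : Finset ι) (t : ι → Finset α) :
    ∑ a ∈ F.biUnion t, f a ≤ ∑ c ∈ F, ∑ a ∈ t c, f a := by
  classical
  induction F using Finset.induction_on with
  | empty => simp
  | insert c F hc ih =>
    rw [Finset.biUnion_insert, Finset.sum_insert hc]
    have := Finset.sum_union_inter (s₁ := t c) (s₂ := F.biUnion t) (f := f)
    have := Finset.sum_nonneg fun a (_ : a ∈ t c ∩ F.biUnion t) => hf a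
    linarith

theorem sum_filter_superset_bernoulli {α : Type*} [DecidableEq α] {E T : Finset α} (hT : T ⊆ E)
    (p : ℝ) :
    ∑ S ∈ E.powerset.filter (T ⊆ ·), p ^ S.card * (1 - p) ^ (E.card - S.card) = p ^ T.card := by
  have h : E.powerset.filter (T ⊆ ·) = (E \ T).powerset.image (T ∪ ·) := by
    rw [← Finset.Icc_eq_image_powerset hT]
    ext S
    simp [and_comm]
  have hd : ∀ U ∈ (E \ T).powerset, Disjoint T U := fun U hU =>
    Finset.disjoint_sdiff.mono_right (Finset.mem_powerset.1 hU)
  rw [h, Finset.sum_image]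
  · have := Finset.sum_pow_mul_eq_add_pow p (1 - p) (E \ T)
    rw [add_sub_cancel, one_pow] at this
    calc _ = ∑ U ∈ (E \ T).powerset,
          p ^ T.card * (p ^ U.card * (1 - p) ^ ((E \ T).card - U.card)) := by
          refine Finset.sum_congr rfl fun U hU => ?_
          rw [Finset.card_union_of_disjoint (hd U hU), Finset.card_sdiff_of_subset hT, pow_add,
            mul_assoc, Nat.sub_sub]
      _ = _ := by rw [← Finset.mul_sum, this, mul_one]
  · intro U hU U' hU' hUU
    have h1 := hd U hU
    have h2 := hd U' hU'
    have : (T ∪ U) \ T = (T ∪ U') \ T := congrArg (· \ T) hUU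
    rwa [Finset.union_sdiff_cancel_left h1, Finset.union_sdiff_cancel_left h2] at this

/-- If each event `Q c` has single-sample probability at least `q`, then with probability at least
`1 - |F| (1 - q)^N` every `Q c`, `c ∈ F`, occurs in one of `N` independent samples. -/
theorem one_sub_le_bernoulliTupleProb {α ι : Type*} [DecidableEq α] (E : Finset α) {p : ℝ}
    (hp0 : 0 ≤ p) (hp1 : p ≤ 1) (N : ℕ) (F : Finset ι) (Q : ι → Finset α → Prop)
    [∀ c, DecidablePred (Q c)] {q : ℝ}
    (hq : ∀ c ∈ F, q ≤ ∑ S ∈ E.powerset.filter (Q c), p ^ S.card * (1 - p) ^ (E.card - S.card)) :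
    1 - F.card * (1 - q) ^ N ≤ bernoulliTupleProb E p N {B | ∀ c ∈ F, ∃ i, Q c (B i)} := by
  classical
  set μ : Finset α → ℝ := fun S => p ^ S.card * (1 - p) ^ (E.card - S.card) with hμ
  have hμ0 : ∀ S, 0 ≤ μ S := fun S =>
    mul_nonneg (pow_nonneg hp0 _) (pow_nonneg (sub_nonneg.2 hp1) _)
  have htot : ∑ S ∈ E.powerset, μ S = 1 := by
    rw [hμ, Finset.sum_pow_mul_eq_add_pow, add_sub_cancel, one_pow]
  have htotN : ∑ f ∈ Fintype.piFinset (fun _ : Fin N => E.powerset), ∏ i, μ (f i) = 1 := by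
    rw [← Finset.prod_univ_sum]
    simp [htot]
  have hbad : ∀ c ∈ F, ∑ f ∈ Fintype.piFinset (fun _ : Fin N => E.powerset.filter (¬ Q c ·)),
      ∏ i, μ (f i) ≤ (1 - q) ^ N := by
    intro c hc
    rw [← Finset.prod_univ_sum, Finset.prod_const, Finset.card_univ, Fintype.card_fin]
    refine pow_le_pow_left₀ (Finset.sum_nonneg fun S _ => hμ0 S) ?_ N
    have := Finset.sum_filter_add_sum_filter_not E.powerset (Q c) μ
    have := hq c hc
    linarith
  set P := Fintype.piFinset (fun _ : Fin N => E.powerset) with hP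
  set A : Set (Fin N → Finset α) := {B | ∀ c ∈ F, ∃ i, Q c (B i)} with hA
  have hW0 : ∀ f : Fin N → Finset α, 0 ≤ ∏ i, μ (f i) :=
    fun f => Finset.prod_nonneg fun i _ => hμ0 _
  have hsplit : bernoulliTupleProb E p N A + ∑ f ∈ P.filter (· ∉ A), ∏ i, μ (f i) = 1 := by
    rw [← htotN, ← Finset.sum_filter_add_sum_filter_not P (· ∈ A)]
    congr 1
    rw [bernoulliTupleProb, Finset.sum_filter]
    exact Finset.sum_congr rfl fun f _ => Set.indicator_apply _ _ _
  have hsub : P.filter (· ∉ A) ⊆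
      F.biUnion fun c => Fintype.piFinset fun _ : Fin N => E.powerset.filter (¬ Q c ·) := by
    intro f hf
    simp only [hP, hA, Finset.mem_filter, Fintype.mem_piFinset, Set.mem_ofPred_eq, not_forall,
      not_exists, Finset.mem_biUnion] at hf ⊢
    obtain ⟨hfE, c, hc, hcf⟩ := hf
    exact ⟨c, hc, fun i => ⟨hfE i, hcf i⟩⟩
  have hle : ∑ f ∈ P.filter (· ∉ A), ∏ i, μ (f i) ≤ F.card * (1 - q) ^ N :=
    calc _ ≤ ∑ f ∈ F.biUnion fun c =>
          Fintype.piFinset fun _ : Fin N => E.powerset.filter (¬ Q c ·), ∏ i, μ (f i) :=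
          Finset.sum_le_sum_of_subset_of_nonneg hsub fun f _ _ => hW0 f
      _ ≤ ∑ c ∈ F, ∑ f ∈ Fintype.piFinset fun _ : Fin N => E.powerset.filter (¬ Q c ·),
          ∏ i, μ (f i) := sum_biUnion_le_of_nonneg hW0 _ _
      _ ≤ ∑ c ∈ F, (1 - q) ^ N := Finset.sum_le_sum hbad
      _ = _ := by rw [Finset.sum_const, nsmul_eq_mul]
  linarith

theorem le_sum_bernoulli_isolated {α : Type*} [DecidableEq α] {E : Finset α} {p : ℝ}
    (hp0 : 0 ≤ p) (hp1 : p ≤ 1) {C : Finset α} (hC : C ⊆ E) (F : Finset (Finset α))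
    (hF : ∀ D ∈ F, D ⊆ E) :
    p ^ C.card * (1 - ∑ D ∈ F, p ^ (D \ C).card) ≤
      ∑ S ∈ E.powerset.filter (fun S => C ⊆ S ∧ ∀ D ∈ F, ¬ D ⊆ S),
        p ^ S.card * (1 - p) ^ (E.card - S.card) := by
  set μ : Finset α → ℝ := fun S => p ^ S.card * (1 - p) ^ (E.card - S.card) with hμ
  have hμ0 : ∀ S, 0 ≤ μ S := fun S =>
    mul_nonneg (pow_nonneg hp0 _) (pow_nonneg (sub_nonneg.2 hp1) _)
  have h1 : ∀ D ∈ F, ∑ S ∈ E.powerset.filter (C ∪ D ⊆ ·), μ S = p ^ C.card * p ^ (D \ C).card := by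
    intro D hD
    rw [hμ, sum_filter_superset_bernoulli (Finset.union_subset hC (hF D hD)), ← pow_add,
      ← Finset.card_union_of_disjoint Finset.disjoint_sdiff, Finset.union_sdiff_self_eq_union]
  have hsub : E.powerset.filter (C ⊆ ·) ⊆
      E.powerset.filter (fun S => C ⊆ S ∧ ∀ D ∈ F, ¬ D ⊆ S) ∪
        F.biUnion fun D => E.powerset.filter (C ∪ D ⊆ ·) := by
    intro S hS
    simp only [Finset.mem_filter, Finset.mem_union, Finset.mem_biUnion] at hS ⊢
    by_cases h : ∀ D ∈ F, ¬ D ⊆ S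
    · exact Or.inl ⟨hS.1, hS.2, h⟩
    · push Not at h
      obtain ⟨D, hD, hDS⟩ := h
      exact Or.inr ⟨D, hD, hS.1, Finset.union_subset hS.2 hDS⟩
  have h2 : p ^ C.card ≤ _ := calc p ^ C.card = ∑ S ∈ E.powerset.filter (C ⊆ ·), μ S :=
        (sum_filter_superset_bernoulli hC p).symm
    _ ≤ _ := Finset.sum_le_sum_of_subset_of_nonneg hsub fun S _ _ => hμ0 S
    _ ≤ _ := by
      rw [← Finset.sum_union_inter]
      exact le_add_of_nonneg_right (Finset.sum_nonneg fun S _ => hμ0 S)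
    _ ≤ _ := add_le_add_right (sum_biUnion_le_of_nonneg hμ0 _ _) _
  rw [Finset.sum_congr rfl h1, ← Finset.mul_sum] at h2
  linarith

theorem sum_pow_card_sdiff_le_half {V : Type*} [Fintype V] [DecidableEq V]
    (G : SimpleGraph V) [DecidableRel G.Adj] {m ℓ : ℕ} (hm : 2 ≤ m)
    (hedges : G.edgeFinset.card = m)
    (hgirth : ∀ C : Finset (Sym2 V), IsCycleSet G C → ℓ < C.card)
    {p : ℝ} (hp0 : 0 ≤ p) (hp1 : p ≤ 1) (hpl : p ^ ℓ = 1 / (m : ℝ) ^ 100)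
    {C : Finset (Sym2 V)} (hC : IsCycleSet G C) (hCℓ : 100 * C.card ≤ 101 * ℓ)
    (F : Finset (Finset (Sym2 V))) (hF : ∀ D ∈ F, IsCycleSet G D ∧ D ≠ C) :
    ∑ D ∈ F, p ^ (D \ C).card ≤ 1 / 2 := by
  have hm2 : (2 : ℝ) ≤ m := by exact_mod_cast hm
  have hm0 : (0 : ℝ) < m := by linarith
  have hℓ : 100 ≤ ℓ := by have := hgirth C hC; omega
  set s := ℓ / 2 with hs
  have hs0 : 0 < s := by omega
  have hterm : ∀ D ∈ F, p ^ (D \ C).card ≤ (1 / (m : ℝ) ^ 10) ^ (D.card / s + 1) := by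
    intro D hD
    have h1 := IsCycleSet.lt_card_sdiff_add_card_sdiff hgirth hC (hF D hD).1 (hF D hD).2
    have h2 := Finset.card_sdiff_add_card_inter C D
    have h3 := Finset.card_sdiff_add_card_inter D C
    rw [Finset.inter_comm] at h3
    have h4 := hgirth D (hF D hD).1
    have h5 : D.card / s * s ≤ D.card := Nat.div_mul_le_self _ _
    have h6 : (D.card / s + 1) * ℓ ≤ (D \ C).card * 10 := by
      have h7 : 100 * ℓ ≤ 202 * s := by omega
      nlinarith [Nat.mul_le_mul_left (D.card / s + 1) h7]
    refine le_of_pow_le_pow_left₀ (n := 10) (by norm_num) (by positivity) ?_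
    calc (p ^ (D \ C).card) ^ 10 = p ^ ((D \ C).card * 10) := (pow_mul _ _ _).symm
      _ ≤ p ^ ((D.card / s + 1) * ℓ) := pow_le_pow_of_le_one hp0 hp1 h6
      _ = (p ^ ℓ) ^ (D.card / s + 1) := by rw [mul_comm, pow_mul]
      _ = _ := by rw [hpl, pow_right_comm, one_div_pow _ 10, ← pow_mul]
  have hcount : ∀ k, ((F.filter fun D => D.card / s = k).card : ℝ) ≤ (2 * m) ^ (k + 1) := by
    intro k
    have := card_cycles_le G hs0 (fun u w hw => by
      have := hgirth _ ⟨u, w, hw, rfl⟩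
      rw [List.toFinset_card_of_nodup hw.isTrail.edges_nodup, SimpleGraph.Walk.length_edges] at this
      omega) (k + 1) (F.filter fun D => D.card / s = k) (fun D hD => by
      obtain ⟨hDF, rfl⟩ := Finset.mem_filter.1 hD
      exact ⟨(hF D hDF).1, mul_comm s _ ▸ (Nat.lt_mul_div_succ D.card hs0).le⟩)
    rw [hedges] at this
    exact_mod_cast this
  have hbase : 2 * (m : ℝ) * (1 / (m : ℝ) ^ 10) ≤ 1 / 4 := by
    rw [mul_one_div, div_le_div_iff₀ (by positivity) (by norm_num)]
    have : (2 : ℝ) ^ 9 ≤ m ^ 9 := pow_le_pow_left₀ (by norm_num) hm2 9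
    nlinarith
  set K := F.sup Finset.card + 1
  have hmaps : ∀ D ∈ F, D.card / s ∈ Finset.range K := fun D hD =>
    Finset.mem_range.2 (Nat.lt_succ_of_le ((Nat.div_le_self _ _).trans
      (Finset.le_sup (f := Finset.card) hD)))
  calc ∑ D ∈ F, p ^ (D \ C).card ≤ ∑ D ∈ F, (1 / (m : ℝ) ^ 10) ^ (D.card / s + 1) :=
        Finset.sum_le_sum hterm
    _ = ∑ k ∈ Finset.range K, ∑ D ∈ F with D.card / s = k,
          (1 / (m : ℝ) ^ 10) ^ (D.card / s + 1) := (Finset.sum_fiberwise_of_maps_to hmaps _).symm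
    _ = ∑ k ∈ Finset.range K, ((F.filter fun D => D.card / s = k).card : ℝ) *
          (1 / (m : ℝ) ^ 10) ^ (k + 1) := by
        refine Finset.sum_congr rfl fun k _ => ?_
        rw [← nsmul_eq_mul, ← Finset.sum_const]
        refine Finset.sum_congr rfl fun D hD => ?_
        rw [(Finset.mem_filter.1 hD).2]
    _ ≤ ∑ k ∈ Finset.range K, 1 / 4 * (1 / 2 : ℝ) ^ k := by
        refine Finset.sum_le_sum fun k _ => ?_
        calc _ ≤ (2 * (m : ℝ)) ^ (k + 1) * (1 / (m : ℝ) ^ 10) ^ (k + 1) := by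
              gcongr
              exact hcount k
          _ = (2 * (m : ℝ) * (1 / (m : ℝ) ^ 10)) ^ (k + 1) := (mul_pow _ _ _).symm
          _ ≤ (1 / 4) ^ (k + 1) := by gcongr
          _ = 1 / 4 * (1 / 4) ^ k := by ring
          _ ≤ _ := by gcongr; norm_num
    _ ≤ 1 / 4 * 2 := by
        rw [← Finset.mul_sum]
        gcongr
        exact sum_geometric_two_le K
    _ = 1 / 2 := by norm_num

theorem inv_pow_le_pow_of_card_le {m ℓ c : ℕ} {p : ℝ} (hp0 : 0 ≤ p) (hp1 : p ≤ 1)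
    (hpl : p ^ ℓ = 1 / (m : ℝ) ^ 100) (hc : 100 * c ≤ 101 * ℓ) : ((m : ℝ) ^ 101)⁻¹ ≤ p ^ c := by
  refine le_of_pow_le_pow_left₀ (n := 100) (by norm_num) (by positivity) ?_
  calc (((m : ℝ) ^ 101)⁻¹) ^ 100 = (p ^ ℓ) ^ 101 := by
        rw [hpl, one_div, ← inv_pow, ← inv_pow, ← pow_mul, ← pow_mul]
    _ = p ^ (101 * ℓ) := by rw [mul_comm, pow_mul]
    _ ≤ p ^ (100 * c) := pow_le_pow_of_le_one hp0 hp1 hc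
    _ = _ := by rw [mul_comm, pow_mul]

theorem one_sub_pow_le_inv_two_pow {m : ℕ} (hm : 2 ≤ m) :
    (1 - ((m : ℝ) ^ 101)⁻¹ * (1 / 2)) ^ (m ^ 200) ≤ ((2 : ℝ) ^ (m ^ 98))⁻¹ := by
  have hm2 : (2 : ℝ) ≤ m := by exact_mod_cast hm
  have hm0 : (0 : ℝ) < m := by linarith
  have hq : ((m : ℝ) ^ 101)⁻¹ ≤ 1 := inv_le_one_of_one_le₀ (one_le_pow₀ (by linarith))
  have hexp : (m : ℝ) ^ 98 ≤ (m ^ 200 : ℕ) * (((m : ℝ) ^ 101)⁻¹ * (1 / 2)) := by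
    have : ((m ^ 200 : ℕ) : ℝ) * (((m : ℝ) ^ 101)⁻¹ * (1 / 2)) = m ^ 98 * (m / 2) := by
      rw [Nat.cast_pow]
      field_simp
    rw [this]
    exact le_mul_of_one_le_right (by positivity) (by linarith)
  calc _ ≤ Real.exp (-(((m : ℝ) ^ 101)⁻¹ * (1 / 2))) ^ (m ^ 200) :=
        pow_le_pow_left₀ (by linarith) (Real.one_sub_le_exp_neg _) _
    _ = Real.exp (-((m ^ 200 : ℕ) * (((m : ℝ) ^ 101)⁻¹ * (1 / 2)))) := by
        rw [← Real.exp_nat_mul, mul_neg]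
    _ ≤ Real.exp (-((m ^ 98 : ℕ) * 1)) := by
        rw [Real.exp_le_exp, neg_le_neg_iff, mul_one, Nat.cast_pow m 98]
        exact hexp
    _ = (Real.exp 1 ^ (m ^ 98))⁻¹ := by rw [Real.exp_neg, Real.exp_nat_mul]
    _ ≤ _ := by
        gcongr
        linarith [Real.add_one_le_exp 1]

/-- If `G` has exactly `m ≥ 2` edges, no cycle of length `≤ ℓ`, and `p^ℓ = 1/m^100`, then with
probability at least `1 - (2m)^4·2^(-m^98)`, among `m^200` independent Bernoulli(p) samples
`B_1, …, B_{m^200}` of the edge set, every cycle of length in `(ℓ, 1.01·ℓ]` is the unique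
cycle of `G` contained in some sample `B_i`. -/
theorem all_short_cycles_isolated_prob_strong {V : Type*} [Fintype V] [DecidableEq V]
    (G : SimpleGraph V) [DecidableRel G.Adj] (m ℓ : ℕ) (hm : 2 ≤ m) (hℓ : 1 ≤ ℓ)
    (hedges : G.edgeFinset.card = m)
    (hgirth : ∀ C : Finset (Sym2 V), IsCycleSet G C → ℓ < C.card)
    (p : ℝ) (hp0 : 0 ≤ p) (hp1 : p ≤ 1) (hpl : p ^ ℓ = 1 / (m : ℝ) ^ 100) :
    1 - (2 * (m : ℝ)) ^ 4 * ((2 : ℝ) ^ (m ^ 98))⁻¹ ≤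
      bernoulliTupleProb G.edgeFinset p (m ^ 200)
        {B | ∀ C : Finset (Sym2 V), IsCycleSet G C → ℓ < C.card → (C.card : ℝ) ≤ 1.01 * ℓ →
          ∃ i : Fin (m ^ 200), C ⊆ B i ∧
            ∀ C' : Finset (Sym2 V), IsCycleSet G C' → C' ≠ C → ¬ C' ⊆ B i} := by
  classical
  have hsubE : ∀ D, IsCycleSet G D → D ⊆ G.edgeFinset := fun D hD e he =>
    SimpleGraph.mem_edgeFinset.2 (hD.mem_edgeSet he)
  set cycles := G.edgeFinset.powerset.filter (IsCycleSet G) with hcycles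
  have hmem : ∀ D, D ∈ cycles ↔ IsCycleSet G D := fun D => by
    rw [hcycles, Finset.mem_filter, Finset.mem_powerset]
    exact ⟨fun h => h.2, fun h => ⟨hsubE D h, h⟩⟩
  set F := cycles.filter (fun C => 100 * C.card ≤ 101 * ℓ) with hF
  have hmemF : ∀ C, C ∈ F ↔ IsCycleSet G C ∧ 100 * C.card ≤ 101 * ℓ := fun C => by
    rw [hF, Finset.mem_filter, hmem]
  have hshort : ∀ n : ℕ, (n : ℝ) ≤ 1.01 * ℓ ↔ 100 * n ≤ 101 * ℓ := fun n => by
    rw [← Nat.cast_le (α := ℝ)]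
    push_cast
    constructor <;> intro h <;> linarith
  set Q : Finset (Sym2 V) → Finset (Sym2 V) → Prop :=
    fun C S => C ⊆ S ∧ ∀ D ∈ cycles.erase C, ¬ D ⊆ S with hQ
  have hq : ∀ C ∈ F, ((m : ℝ) ^ 101)⁻¹ * (1 / 2) ≤ ∑ S ∈ G.edgeFinset.powerset.filter (Q C),
      p ^ S.card * (1 - p) ^ (G.edgeFinset.card - S.card) := by
    intro C hC
    obtain ⟨hCc, hCℓ⟩ := (hmemF C).1 hC
    have hD : ∀ D ∈ cycles.erase C, IsCycleSet G D ∧ D ≠ C := fun D hD =>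
      ⟨(hmem D).1 (Finset.mem_of_mem_erase hD), Finset.ne_of_mem_erase hD⟩
    have hiso := le_sum_bernoulli_isolated hp0 hp1 (hsubE C hCc) (cycles.erase C)
      fun D h => hsubE D (hD D h).1
    refine le_trans ?_ (hiso.trans_eq (Finset.sum_congr
      (by ext S; simp only [Finset.mem_filter, hQ]) fun _ _ => rfl))
    have hsum := sum_pow_card_sdiff_le_half G hm hedges hgirth hp0 hp1 hpl hCc hCℓ _ hD
    exact mul_le_mul (inv_pow_le_pow_of_card_le hp0 hp1 hpl hCℓ) (by linarith) (by norm_num)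
      (pow_nonneg hp0 _)
  have hcard : (F.card : ℝ) ≤ (2 * m) ^ 4 := by
    rcases F.eq_empty_or_nonempty with h | ⟨C, hC⟩
    · rw [h, Finset.card_empty, Nat.cast_zero]
      positivity
    · have hℓ' : 100 ≤ ℓ := by
        have := (hmemF C).1 hC
        have := hgirth C this.1
        omega
      have := card_cycles_le G (s := ℓ / 2) (by omega) (fun u w hw => by
        have := hgirth _ ⟨u, w, hw, rfl⟩
        rw [List.toFinset_card_of_nodup hw.isTrail.edges_nodup,
          SimpleGraph.Walk.length_edges] at this
        omega) 4 F (fun D hD => ⟨((hmemF D).1 hD).1, by have := ((hmemF D).1 hD).2; omega⟩)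
      rw [hedges] at this
      exact_mod_cast this
  have hset : {B : Fin (m ^ 200) → Finset (Sym2 V) | ∀ C : Finset (Sym2 V), IsCycleSet G C →
      ℓ < C.card → (C.card : ℝ) ≤ 1.01 * ℓ → ∃ i : Fin (m ^ 200), C ⊆ B i ∧
        ∀ C' : Finset (Sym2 V), IsCycleSet G C' → C' ≠ C → ¬ C' ⊆ B i} =
      {B | ∀ C ∈ F, ∃ i, Q C (B i)} := by
    ext B
    simp only [Set.mem_ofPred_eq, hmemF, hshort, hQ, Finset.mem_erase, hmem]
    constructor
    · intro h C hC
      obtain ⟨i, hi, hi'⟩ := h C hC.1 (hgirth C hC.1) hC.2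
      exact ⟨i, hi, fun D hD => hi' D hD.2 hD.1⟩
    · intro h C hC _ hCℓ
      obtain ⟨i, hi, hi'⟩ := h C ⟨hC, hCℓ⟩
      exact ⟨i, hi, fun D hD hne => hi' D ⟨hne, hD⟩⟩
  rw [hset]
  refine le_trans ?_ (one_sub_le_bernoulliTupleProb G.edgeFinset hp0 hp1 (m ^ 200) F Q hq)
  have hpow := one_sub_pow_le_inv_two_pow hm
  have h0 : (F.card : ℝ) * (1 - ((m : ℝ) ^ 101)⁻¹ * (1 / 2)) ^ (m ^ 200) ≤
      (2 * (m : ℝ)) ^ 4 * ((2 : ℝ) ^ (m ^ 98))⁻¹ :=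
    (mul_le_mul_of_nonneg_left hpow (Nat.cast_nonneg _)).trans
      (mul_le_mul_of_nonneg_right hcard (by positivity))
  linarith
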